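/- Fix θ ∈ ℝ^d and let c ∈ ℝ satisfy c ≤ f_i(θ) for all i ∈ [N] (in the paper, c is the global minimum F̃(−∞) = min_θ min_i f_i(θ)). Let R_(k)(θ) denote the k-th smallest value among f_1(θ),…,f_N(θ). Then for every k ∈ {2,…,N−1} and every t > 0: |exp((R_(k)(θ) − c)·t) − 1| ≤ (N/(N−k)) · |exp((R̃(t;θ) − c)·t) − 1|. -/

import Mathlib

open Real Finset

/-- The `t`-tilted empirical loss for `t ≠ 0`:
`R̃(t;θ) = (1/t)·log((1/N)·Σᵢ exp(t·fᵢ(θ)))`. -/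
noncomputable def tiltedLoss {d N : ℕ} (f : Fin N → EuclideanSpace ℝ (Fin d) → ℝ) (t : ℝ)
    (θ : EuclideanSpace ℝ (Fin d)) : ℝ :=
  (1 / t) * Real.log ((1 / (N : ℝ)) * ∑ i, Real.exp (t * f i θ))

/-- The `k`-th smallest entry (1-indexed, for `1 ≤ k ≤ N`) of the loss vector
`(f₁(θ),…,f_N(θ))`, i.e. the `k`-th order statistic `R₍ₖ₎(θ)`, obtained via the sorting
permutation `Tuple.sort`. -/
noncomputable def kthSmallestLoss {d N : ℕ} (f : Fin N → EuclideanSpace ℝ (Fin d) → ℝ)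
    (θ : EuclideanSpace ℝ (Fin d)) (k : Fin N) : ℝ :=
  (fun i => f i θ) (Tuple.sort (fun i => f i θ) k)

/-- A monotone nonnegative tuple has sum at least `N - j` times its `j`-th entry (0-indexed). -/
theorem Monotone.sub_mul_le_sum {N : ℕ} {g : Fin N → ℝ} (hg : Monotone g) (h0 : ∀ i, 0 ≤ g i)
    (j : Fin N) : ((N : ℝ) - (j : ℕ)) * g j ≤ ∑ i, g i := by
  calc ((N : ℝ) - (j : ℕ)) * g j = ∑ _i ∈ Finset.Ici j, g j := by
        rw [Finset.sum_const, Fin.card_Ici, nsmul_eq_mul, Nat.cast_sub j.isLt.le]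
    _ ≤ ∑ i ∈ Finset.Ici j, g i := Finset.sum_le_sum fun i hi => hg (Finset.mem_Ici.mp hi)
    _ ≤ ∑ i, g i :=
        Finset.sum_le_sum_of_subset_of_nonneg (Finset.subset_univ _) fun i _ _ => h0 i

/-- The shifted exponential of the tilted loss is the mean of those of the losses. -/
theorem mul_exp_tiltedLoss_sub_one {d N : ℕ} (hN : 0 < N)
    (f : Fin N → EuclideanSpace ℝ (Fin d) → ℝ) (θ : EuclideanSpace ℝ (Fin d)) (c : ℝ)
    {t : ℝ} (ht : t ≠ 0) :
    (N : ℝ) * (Real.exp ((tiltedLoss f t θ - c) * t) - 1) =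
      ∑ i, (Real.exp ((f i θ - c) * t) - 1) := by
  have hN' : (0 : ℝ) < N := Nat.cast_pos.mpr hN
  have hne : (Finset.univ : Finset (Fin N)).Nonempty := ⟨⟨0, hN⟩, Finset.mem_univ _⟩
  have hS : 0 < (1 / (N : ℝ)) * ∑ i, Real.exp (t * f i θ) :=
    mul_pos (by positivity) (Finset.sum_pos (fun i _ => Real.exp_pos _) hne)
  have hexp : (tiltedLoss f t θ - c) * t =
      Real.log ((1 / (N : ℝ)) * ∑ i, Real.exp (t * f i θ)) + -(c * t) := by
    unfold tiltedLoss
    field_simp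
    ring
  have hterm : ∀ i, Real.exp ((f i θ - c) * t) =
      Real.exp (t * f i θ) * Real.exp (-(c * t)) := fun i => by
    rw [← Real.exp_add]
    ring_nf
  rw [hexp, Real.exp_add, Real.exp_log hS]
  simp only [hterm, Finset.sum_sub_distrib, ← Finset.sum_mul, Finset.sum_const,
    Finset.card_univ, Fintype.card_fin, nsmul_eq_mul]
  field_simp

/-- **Order-statistic bound via the tilted objective.** Fix `θ` and let `c` be a lower bound
on all losses at `θ` (in the paper, `c = F̃(−∞)` is the global minimum loss). Then for every
`k ∈ {2,…,N−1}` and every `t > 0`, the `k`-th smallest loss `R₍ₖ₎(θ)` satisfies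
`|exp((R₍ₖ₎(θ) − c)·t) − 1| ≤ (N/(N−k))·|exp((R̃(t;θ) − c)·t) − 1|`. -/
theorem tilted_kth_loss_bound {d N : ℕ}
    (f : Fin N → EuclideanSpace ℝ (Fin d) → ℝ) (θ : EuclideanSpace ℝ (Fin d))
    (c : ℝ) (hc : ∀ i, c ≤ f i θ)
    (k : ℕ) (hk2 : 2 ≤ k) (hkN : k ≤ N - 1)
    (t : ℝ) (ht : 0 < t) :
    |Real.exp ((kthSmallestLoss f θ ⟨k - 1, by omega⟩ - c) * t) - 1| ≤
      ((N : ℝ) / ((N : ℝ) - (k : ℝ))) * |Real.exp ((tiltedLoss f t θ - c) * t) - 1| := by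
  have hkN' : k < N := by omega
  have hden : (0 : ℝ) < (N : ℝ) - k := sub_pos.mpr (Nat.cast_lt.mpr hkN')
  set σ := Tuple.sort fun i => f i θ
  set j : Fin N := ⟨k - 1, by omega⟩
  let g : Fin N → ℝ := fun i => Real.exp ((f (σ i) θ - c) * t) - 1
  have hmono : Monotone g := fun a b hab => by
    have hsort : f (σ a) θ ≤ f (σ b) θ := Tuple.monotone_sort (fun i => f i θ) hab
    dsimp only [g]
    gcongr
  have hnonneg : ∀ i, 0 ≤ g i := fun i =>
    sub_nonneg.mpr (Real.one_le_exp (mul_nonneg (sub_nonneg.mpr (hc _)) ht.le))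
  have hsum : ∑ i, g i = (N : ℝ) * (Real.exp ((tiltedLoss f t θ - c) * t) - 1) := by
    rw [mul_exp_tiltedLoss_sub_one (by omega) f θ c ht.ne']
    exact Equiv.sum_comp σ fun i => Real.exp ((f i θ - c) * t) - 1
  have hj : ((j : ℕ) : ℝ) ≤ k := Nat.cast_le.mpr (Nat.sub_le k 1)
  have hbound : ((N : ℝ) - k) * g j ≤ ∑ i, g i :=
    (mul_le_mul_of_nonneg_right (by linarith) (hnonneg j)).trans
      (hmono.sub_mul_le_sum hnonneg j)
  change |g j| ≤ _
  rw [abs_of_nonneg (hnonneg j), div_mul_eq_mul_div, le_div_iff₀ hden, mul_comm]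
  calc ((N : ℝ) - k) * g j ≤ (N : ℝ) * (Real.exp ((tiltedLoss f t θ - c) * t) - 1) :=
        hbound.trans_eq hsum
    _ ≤ (N : ℝ) * |Real.exp ((tiltedLoss f t θ - c) * t) - 1| := by
        gcongr
        exact le_abs_self _
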